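/- Let (Ω, 𝒜) be a measurable space and K : Ω → 𝒦'(ℂⁿ) a random compact set. Then its rationally convex hull, defined pointwise by [ℛ-hull K](ω) = ℛ-hull(K(ω)) (which is a nonempty compact subset of ℂⁿ), is a random compact set, i.e. ω ↦ ℛ-hull(K(ω)) is measurable from Ω to 𝒦'(ℂⁿ). -/

import Mathlib

open TopologicalSpace MvPolynomial

/-- Borel σ-algebra on the space `𝒦'(X)` of nonempty compact subsets of a
metric space `X`, equipped with the Hausdorff distance. -/
noncomputable instance nonemptyCompactsMeasurableSpace
    {X : Type*} [MetricSpace X] :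
    MeasurableSpace (NonemptyCompacts X) := borel _

/-- The rationally convex hull of a set `K ⊆ ℂⁿ`: the set of points `z` such
that `|r z| ≤ max_{x ∈ K} |r x|` for every rational function `r = p/q` whose
denominator `q` has no zeros on `K ∪ {z}`. -/
noncomputable def ratHull {n : ℕ} (K : Set (Fin n → ℂ)) : Set (Fin n → ℂ) :=
  {z | ∀ p q : MvPolynomial (Fin n) ℂ,
    (∀ x ∈ insert z K, eval x q ≠ 0) →
    ‖eval z p / eval z q‖ ≤ sSup ((fun x => ‖eval x p / eval x q‖) '' K)}

/-- Membership in the rationally convex hull of a compact set is detected by zeros of polynomials. -/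
theorem notMem_ratHull_iff {n : ℕ} {K : Set (Fin n → ℂ)} (hK : IsCompact K) (hne : K.Nonempty)
    (z : Fin n → ℂ) :
    z ∉ ratHull K ↔ ∃ q : MvPolynomial (Fin n) ℂ, eval z q = 0 ∧ ∀ x ∈ K, eval x q ≠ 0 := by
  constructor
  · intro hz
    simp only [ratHull, Set.mem_ofPred_eq, not_forall, not_le] at hz
    obtain ⟨p, q, hq, hlt⟩ := hz
    refine ⟨C (eval z q) * p - C (eval z p) * q, by simp [mul_comm], fun x hx h0 => ?_⟩
    have hqx : eval x q ≠ 0 := hq x (Set.mem_insert_of_mem _ hx)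
    have hqz : eval z q ≠ 0 := hq z (Set.mem_insert _ _)
    have hcont : ContinuousOn (fun x => ‖eval x p / eval x q‖) K :=
      ((MvPolynomial.continuous_eval p).continuousOn.div
        (MvPolynomial.continuous_eval q).continuousOn
        fun y hy => hq y (Set.mem_insert_of_mem _ hy)).norm
    have heq : eval x p / eval x q = eval z p / eval z q := by
      rw [div_eq_div_iff hqx hqz]
      simp only [map_sub, map_mul, eval_C] at h0
      linear_combination h0
    have hle := le_csSup (hK.image_of_continuousOn hcont).bddAbove (Set.mem_image_of_mem _ hx)
    simp only [heq] at hle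
    exact absurd hle (not_le.mpr hlt)
  · rintro ⟨q, hqz, hq⟩ hz
    obtain ⟨x₀, hx₀, hmin⟩ :=
      hK.exists_isMinOn hne (MvPolynomial.continuous_eval q).norm.continuousOn
    set m : ℝ := ‖eval x₀ q‖
    have hmpos : 0 < m := norm_pos_iff.mpr (hq x₀ hx₀)
    have hε : ‖((m / 3 : ℝ) : ℂ)‖ = m / 3 := by
      rw [Complex.norm_real, Real.norm_of_nonneg (by positivity)]
    have hlow : ∀ x ∈ K, 2 * m / 3 ≤ ‖eval x q + ((m / 3 : ℝ) : ℂ)‖ := fun x hx => by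
      have h₁ : m ≤ ‖eval x q‖ := hmin hx
      have h₂ := norm_sub_le (eval x q + ((m / 3 : ℝ) : ℂ)) ((m / 3 : ℝ) : ℂ)
      rw [add_sub_cancel_right, hε] at h₂
      linarith
    have hle := hz 1 (q + C ((m / 3 : ℝ) : ℂ)) (by
      rintro x (rfl | hx)
      · rw [map_add, eval_C, hqz, zero_add, ← norm_pos_iff, hε]
        positivity
      · rw [map_add, eval_C, ← norm_pos_iff]
        exact lt_of_lt_of_le (by positivity) (hlow x hx))
    have hsup : sSup ((fun x => ‖eval x (1 : MvPolynomial (Fin n) ℂ) /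
        eval x (q + C ((m / 3 : ℝ) : ℂ))‖) '' K) ≤ 1 / (2 * m / 3) := by
      refine csSup_le (hne.image _) ?_
      rintro _ ⟨x, hx, rfl⟩
      simp only [map_one, map_add, eval_C, norm_div, norm_one]
      exact one_div_le_one_div_of_le (by positivity) (hlow x hx)
    rw [map_one, map_add, eval_C, hqz, zero_add, norm_div, norm_one, hε] at hle
    have hlt : 1 / (2 * m / 3) < 1 / (m / 3) :=
      one_div_lt_one_div_of_lt (by positivity) (by linarith)
    linarith

/-- The rationally convex hulls avoiding a fixed compact set form an open condition. -/
theorem isOpen_setOf_disjoint_ratHull {n : ℕ} {C : Set (Fin n → ℂ)} (hC : IsCompact C) :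
    IsOpen {K : NonemptyCompacts (Fin n → ℂ) | ∀ z ∈ C, z ∉ ratHull (K : Set (Fin n → ℂ))} := by
  rw [isOpen_iff_eventually]
  intro K hK
  refine hC.eventually_forall_of_forall_eventually fun z hz => ?_
  obtain ⟨q, hqz, hq⟩ := (notMem_ratHull_iff K.isCompact K.nonempty z).mp (hK z hz)
  have hcont : Continuous fun x => ‖eval x q‖ := (MvPolynomial.continuous_eval q).norm
  obtain ⟨x₀, hx₀, hmin⟩ := K.isCompact.exists_isMinOn K.nonempty hcont.continuousOn
  obtain ⟨δ, hδ₀, hδ⟩ := exists_between (norm_pos_iff.mpr (hq x₀ hx₀))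
  have hU : {L : NonemptyCompacts (Fin n → ℂ) | (L : Set (Fin n → ℂ)) ⊆ {x | δ < ‖eval x q‖}} ∈
      nhds K :=
    (NonemptyCompacts.isOpen_subsets_of_isOpen (isOpen_lt continuous_const hcont)).mem_nhds
      fun x hx => hδ.trans_le (hmin hx)
  have hV : {w : Fin n → ℂ | ‖eval w q‖ < δ} ∈ nhds z :=
    (isOpen_lt hcont continuous_const).mem_nhds (by simpa [hqz] using hδ₀)
  filter_upwards [prod_mem_nhds hU hV] with ⟨L, w⟩ ⟨hL, hw⟩
  refine (notMem_ratHull_iff L.isCompact L.nonempty w).mpr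
    ⟨q - MvPolynomial.C (eval w q), by simp, fun x hx h0 => ?_⟩
  rw [map_sub, eval_C, sub_eq_zero] at h0
  have h₁ : δ < ‖eval x q‖ := hL hx
  have h₂ : ‖eval w q‖ < δ := hw
  rw [h0] at h₁
  exact lt_asymm h₁ h₂

/-- Rationally convex hulls of random compact sets avoid a given σ-compact set measurably. -/
theorem measurableSet_setOf_disjoint_ratHull {n : ℕ} {S : Set (Fin n → ℂ)}
    (hS : IsSigmaCompact S) :
    MeasurableSet
      {K : NonemptyCompacts (Fin n → ℂ) | ∀ z ∈ S, z ∉ ratHull (K : Set (Fin n → ℂ))} := by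
  have : BorelSpace (NonemptyCompacts (Fin n → ℂ)) := ⟨rfl⟩
  obtain ⟨C, hC, rfl⟩ := hS
  have h : {K : NonemptyCompacts (Fin n → ℂ) |
      ∀ z ∈ ⋃ i, C i, z ∉ ratHull (K : Set (Fin n → ℂ))} =
      ⋂ i, {K : NonemptyCompacts (Fin n → ℂ) | ∀ z ∈ C i, z ∉ ratHull (K : Set (Fin n → ℂ))} := by
    ext K
    simp only [Set.mem_ofPred_eq, Set.mem_iUnion, Set.mem_iInter]
    exact ⟨fun h i z hz => h z ⟨i, hz⟩, fun h z ⟨i, hz⟩ => h i z hz⟩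
  rw [h]
  exact MeasurableSet.iInter fun i => (isOpen_setOf_disjoint_ratHull (hC i)).measurableSet

theorem IsClosed.isSigmaCompact_of_sigmaCompactSpace {X : Type*} [TopologicalSpace X]
    [SigmaCompactSpace X] {F : Set X} (hF : IsClosed F) : IsSigmaCompact F :=
  isSigmaCompact_univ.of_isClosed_subset hF (Set.subset_univ F)

theorem IsOpen.isSigmaCompact_of_sigmaCompactSpace {X : Type*} [PseudoEMetricSpace X]
    [SigmaCompactSpace X] {U : Set X} (hU : IsOpen U) : IsSigmaCompact U := by
  obtain ⟨F, hF, -, rfl, -⟩ := hU.exists_iUnion_isClosed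
  exact isSigmaCompact_iUnion F fun i => (hF i).isSigmaCompact_of_sigmaCompactSpace

/-- The Borel σ-algebra of the hyperspace of nonempty compact sets is generated by the hit and
miss sets of open sets. -/
theorem measurable_nonemptyCompacts {Ω X : Type*} [MeasurableSpace Ω] [MetricSpace X]
    [SecondCountableTopology X] {f : Ω → NonemptyCompacts X}
    (hsub : ∀ U : Set X, IsOpen U → MeasurableSet {ω | (f ω : Set X) ⊆ U})
    (hhit : ∀ U : Set X, IsOpen U → MeasurableSet {ω | ((f ω : Set X) ∩ U).Nonempty}) :
    Measurable f := by
  have hgen : (NonemptyCompacts.topology : TopologicalSpace (NonemptyCompacts X)) = _ :=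
    induced_generateFrom_eq
  have hborel := borel_eq_generateFrom_of_subbasis hgen
  change @Measurable Ω _ _ (borel _) f
  rw [hborel]
  refine measurable_generateFrom ?_
  rintro _ ⟨_, ⟨U, hU, rfl⟩ | ⟨U, hU, rfl⟩, rfl⟩
  · exact hsub U hU
  · exact hhit U hU

/-- **The rationally convex hull of a random compact set is a random compact
set.** If `K : Ω → 𝒦'(ℂⁿ)` is measurable and `Krat : Ω → 𝒦'(ℂⁿ)` is defined
pointwise by `Krat ω = ℛ-hull (K ω)` (a nonempty compact set), then `Krat`
is measurable. -/
theorem ratHull_random_compact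
    {Ω : Type*} [MeasurableSpace Ω] {n : ℕ}
    (K : Ω → NonemptyCompacts (Fin n → ℂ)) (hK : Measurable K)
    (Krat : Ω → NonemptyCompacts (Fin n → ℂ))
    (hKrat : ∀ ω, (Krat ω : Set (Fin n → ℂ)) = ratHull (K ω)) :
    Measurable Krat := by
  refine measurable_nonemptyCompacts (fun U hU => ?_) fun U hU => ?_
  · convert hK (measurableSet_setOf_disjoint_ratHull
      hU.isClosed_compl.isSigmaCompact_of_sigmaCompactSpace) using 1
    ext ω
    simp only [hKrat, Set.mem_ofPred_eq, Set.mem_preimage, Set.mem_compl_iff]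
    exact ⟨fun h z hz hz' => hz (h hz'), fun h z hz => by_contra fun hz' => h z hz' hz⟩
  · convert (hK (measurableSet_setOf_disjoint_ratHull
      hU.isSigmaCompact_of_sigmaCompactSpace)).compl using 1
    ext ω
    simp only [hKrat, Set.mem_ofPred_eq, Set.mem_preimage, Set.mem_compl_iff, not_forall, not_not]
    exact ⟨fun ⟨z, hz, hzU⟩ => ⟨z, hzU, hz⟩, fun ⟨z, hzU, hz⟩ => ⟨z, hz, hzU⟩⟩
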